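/- arXiv:2502.15929 — 5 statements merged into one kernel-verified Lean document; each statement's English description precedes it below -/
import Mathlib

section
/- Let d ≥ 2 be an integer, let σ > 0, ε > 0 be real numbers with σε < 1, let r > 0, and define h(r) = min( r(1 − εσ) + (1 − (εσ)²)/2 , 2r ). Then for every y ∈ ℝ^d with ‖y‖₂ = r, one has ‖y − e₁‖₂ − ‖y‖₂ ≥ σε if and only if y₁ ≤ −r + h(r). -/
theorem stmt_5 (d : ℕ) (hd : 2 ≤ d) (σ ε : ℝ) (hσ : 0 < σ) (hε : 0 < ε) (hτ : σ * ε < 1)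
    (r : ℝ) (hr : 0 < r) :
    ∀ y : EuclideanSpace ℝ (Fin d), ‖y‖ = r →
      (σ * ε ≤ ‖y - EuclideanSpace.single (⟨0, by omega⟩ : Fin d) (1 : ℝ)‖ - ‖y‖
        ↔ y ⟨0, by omega⟩ ≤ -r + min (r * (1 - ε * σ) + (1 - (ε * σ) ^ 2) / 2) (2 * r)) := by
  intro y hy
  generalize (⟨0, by omega⟩ : Fin d) = i
  have hsq : ‖y - EuclideanSpace.single i (1 : ℝ)‖ ^ 2 = r ^ 2 - 2 * y i + 1 := by
    rw [norm_sub_sq_real, hy, EuclideanSpace.inner_single_right]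
    simp
  have hle : y i ≤ r := hy ▸ (le_abs_self _).trans (PiLp.norm_apply_le y i)
  have ht : 0 < σ * ε := mul_pos hσ hε
  rw [hy, le_sub_iff_add_le, ← sq_le_sq₀ (by positivity) (norm_nonneg _), hsq, mul_comm ε σ, ← min_add_add_left,
    le_min_iff]
  constructor
  · exact fun h => ⟨by linarith, by linarith⟩
  · rintro ⟨h, -⟩
    linarith
end

section
/- Let d ≥ 2 be an integer and let τ ∈ (0, 1) be a real number. Define h(r) = min( r(1 − τ) + (1 − τ²)/2 , 2r ) for r > 0, define I_x(a, b) = (∫_0^x t^{a−1}(1−t)^{b−1} dt) / (∫_0^1 t^{a−1}(1−t)^{b−1} dt) for x ∈ [0,1], and define F(r) = (1/2)·I_{(2r·h(r) − h(r)²)/r²}((d−1)/2, 1/2) if h(r) ≤ r, and F(r) = 1 − (1/2)·I_{(2r·h(r) − h(r)²)/r²}((d−1)/2, 1/2) if h(r) > r. Then F is monotone decreasing (antitone) on (0, ∞). -/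
noncomputable def regIncBeta (x a b : ℝ) : ℝ :=
    (∫ t in (0:ℝ)..x, t ^ (a - 1) * (1 - t) ^ (b - 1)) /
      (∫ t in (0:ℝ)..1, t ^ (a - 1) * (1 - t) ^ (b - 1))

theorem intervalIntegrable_beta {a b : ℝ} (ha : 0 < a) (hb : 0 < b) :
    IntervalIntegrable (fun t : ℝ => t ^ (a - 1) * (1 - t) ^ (b - 1)) MeasureTheory.volume 0 1 := by
  have hc := Complex.betaIntegral_convergent (u := a) (v := b) (by simpa) (by simpa)
  rw [intervalIntegrable_iff_integrableOn_Ioc_of_le zero_le_one] at hc ⊢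
  refine MeasureTheory.IntegrableOn.congr_fun hc.re (fun x hx => ?_) measurableSet_Ioc
  have hx1 : (0 : ℝ) ≤ 1 - x := sub_nonneg.2 hx.2
  have key : (x : ℂ) ^ ((a : ℂ) - 1) * (1 - (x : ℂ)) ^ ((b : ℂ) - 1)
      = ((x ^ (a - 1) * (1 - x) ^ (b - 1) : ℝ) : ℂ) := by
    push_cast [Complex.ofReal_cpow hx.1.le, Complex.ofReal_cpow hx1]
    rfl
  simp only [key, RCLike.re_to_complex, Complex.ofReal_re]

theorem beta_integrand_nonneg_ae (a b : ℝ) {x : ℝ} (hx : x ≤ 1) :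
    0 ≤ᵐ[MeasureTheory.volume.restrict (Set.Ioc 0 x)]
      fun t : ℝ => t ^ (a - 1) * (1 - t) ^ (b - 1) := by
  refine MeasureTheory.ae_restrict_of_forall_mem measurableSet_Ioc fun t ht => ?_
  exact mul_nonneg (Real.rpow_nonneg ht.1.le _)
    (Real.rpow_nonneg (sub_nonneg.2 (ht.2.trans hx)) _)

theorem beta_integral_mono {a b : ℝ} (ha : 0 < a) (hb : 0 < b) {x y : ℝ}
    (hx : 0 ≤ x) (hxy : x ≤ y) (hy : y ≤ 1) :
    (∫ t in (0:ℝ)..x, t ^ (a - 1) * (1 - t) ^ (b - 1)) ≤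
      ∫ t in (0:ℝ)..y, t ^ (a - 1) * (1 - t) ^ (b - 1) := by
  refine intervalIntegral.integral_mono_interval le_rfl hx hxy (beta_integrand_nonneg_ae a b hy) ?_
  refine (intervalIntegrable_beta ha hb).mono_set ?_
  rw [Set.uIcc_of_le (hx.trans hxy), Set.uIcc_of_le zero_le_one]
  exact Set.Icc_subset_Icc_right hy

theorem beta_integral_one_nonneg (a b : ℝ) :
    0 ≤ ∫ t in (0:ℝ)..1, t ^ (a - 1) * (1 - t) ^ (b - 1) :=
  intervalIntegral.integral_nonneg zero_le_one fun _ ht =>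
    mul_nonneg (Real.rpow_nonneg ht.1 _) (Real.rpow_nonneg (sub_nonneg.2 ht.2) _)

theorem regIncBeta_mono {a b : ℝ} (ha : 0 < a) (hb : 0 < b) {x y : ℝ}
    (hx : 0 ≤ x) (hxy : x ≤ y) (hy : y ≤ 1) : regIncBeta x a b ≤ regIncBeta y a b :=
  div_le_div_of_nonneg_right (beta_integral_mono ha hb hx hxy hy) (beta_integral_one_nonneg a b)

theorem regIncBeta_le_one {a b : ℝ} (ha : 0 < a) (hb : 0 < b) {x : ℝ}
    (hx : 0 ≤ x) (hx1 : x ≤ 1) : regIncBeta x a b ≤ 1 :=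
  div_le_one_of_le₀ (beta_integral_mono ha hb hx hx1 le_rfl) (beta_integral_one_nonneg a b)

/-- The normalised area of a spherical cap, as a function of the cosine of its angular radius. -/
theorem antitoneOn_capFraction {a b : ℝ} (ha : 0 < a) (hb : 0 < b) :
    AntitoneOn (fun u : ℝ => if 0 ≤ u then 1 / 2 * regIncBeta (1 - u ^ 2) a b
      else 1 - 1 / 2 * regIncBeta (1 - u ^ 2) a b) (Set.Icc (-1) 1) := by
  intro u hu v hv huv
  have hu2 : 0 ≤ 1 - u ^ 2 := by nlinarith [hu.1, hu.2]
  have hv2 : 0 ≤ 1 - v ^ 2 := by nlinarith [hv.1, hv.2]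
  have hu1 : 1 - u ^ 2 ≤ 1 := by nlinarith
  have hv1 : 1 - v ^ 2 ≤ 1 := by nlinarith
  have hIu := regIncBeta_le_one ha hb hu2 hu1
  have hIv := regIncBeta_le_one ha hb hv2 hv1
  dsimp only
  split_ifs with h1 h2 h2
  · have := regIncBeta_mono ha hb hv2 (by nlinarith : 1 - v ^ 2 ≤ 1 - u ^ 2) hu1
    linarith
  · linarith
  · linarith
  · have := regIncBeta_mono ha hb hu2 (by nlinarith : 1 - u ^ 2 ≤ 1 - v ^ 2) hv1
    linarith

theorem stmt_7 (d : ℕ) (hd : 2 ≤ d) (τ : ℝ) (hτ : τ ∈ Set.Ioo (0:ℝ) 1)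
    (h F : ℝ → ℝ)
    (hh : ∀ r, h r = min (r * (1 - τ) + (1 - τ ^ 2) / 2) (2 * r))
    (hF : ∀ r, F r =
      if h r ≤ r then
        (1 / 2) * regIncBeta ((2 * r * h r - (h r) ^ 2) / r ^ 2) (((d : ℝ) - 1) / 2) (1 / 2)
      else
        1 - (1 / 2) * regIncBeta ((2 * r * h r - (h r) ^ 2) / r ^ 2) (((d : ℝ) - 1) / 2) (1 / 2)) :
    AntitoneOn F (Set.Ioi 0) := by
  obtain ⟨hτ0, hτ1⟩ := hτ
  have hd' : (2 : ℝ) ≤ d := by exact_mod_cast hd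
  have hc : 0 < 1 - τ ^ 2 := by nlinarith
  set u : ℝ → ℝ := fun r => max (τ - (1 - τ ^ 2) / 2 / r) (-1) with hu
  have h_eq : ∀ r, 0 < r → h r = r * (1 - u r) := by
    intro r hr
    rw [hh, hu]
    dsimp only
    rw [← min_sub_sub_left, mul_min_of_nonneg _ _ hr.le]
    congr 1
    · field_simp
      ring
    · ring
  have hu_mem : Set.MapsTo u (Set.Ioi 0) (Set.Icc (-1) 1) := by
    intro r hr
    have : 0 < (1 - τ ^ 2) / 2 / r := div_pos (half_pos hc) hr
    exact ⟨le_max_right _ _, max_le (by linarith) (by norm_num)⟩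
  have hu_mono : MonotoneOn u (Set.Ioi 0) := by
    intro r hr s _ hrs
    exact max_le_max_right _
      (sub_le_sub_left (div_le_div_of_nonneg_left (half_pos hc).le hr hrs) _)
  have hcap := antitoneOn_capFraction (a := ((d : ℝ) - 1) / 2) (b := 1 / 2)
    (by linarith) (by norm_num)
  refine (AntitoneOn.comp_MonotoneOn hcap hu_mono hu_mem).congr fun r hr => ?_
  have hr0 : 0 < r := hr
  have harg : (2 * r * h r - (h r) ^ 2) / r ^ 2 = 1 - u r ^ 2 := by
    rw [h_eq r hr0]
    field_simp
    ring
  have hcond : h r ≤ r ↔ 0 ≤ u r := by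
    rw [h_eq r hr0, mul_le_iff_le_one_right hr0, sub_le_self_iff]
  rw [hF, harg]
  simp only [hcond, Function.comp_apply]
end

section
/- Let d ≥ 2 be an integer and let τ ∈ (0, 1) be a real number. Define H(R) = R(1 − τ) − (1 − τ²)/2 for R > 0, define I_x(a, b) = (∫_0^x t^{a−1}(1−t)^{b−1} dt) / (∫_0^1 t^{a−1}(1−t)^{b−1} dt), and define U(R) = (1/2)·I_{(2R·H(R) − H(R)²)/R²}((d−1)/2, 1/2). Then U is monotone increasing on [(1 + τ)/2, ∞). -/
lemma betaIntegrand_nonneg {t : ℝ} (a b : ℝ) (h0 : 0 ≤ t) (h1 : t ≤ 1) :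
    0 ≤ t ^ (a - 1) * (1 - t) ^ (b - 1) :=
  mul_nonneg (Real.rpow_nonneg h0 _) (Real.rpow_nonneg (by linarith) _)

lemma intervalIntegrable_betaIntegrand {a x : ℝ} (b : ℝ) (ha : 0 < a) (h0 : 0 ≤ x) (h1 : x < 1) :
    IntervalIntegrable (fun t : ℝ => t ^ (a - 1) * (1 - t) ^ (b - 1)) MeasureTheory.volume 0 x := by
  refine (intervalIntegral.intervalIntegrable_rpow' (by linarith)).mul_continuousOn ?_
  refine ContinuousOn.rpow_const (by fun_prop) fun t ht => Or.inl ?_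
  rw [Set.uIcc_of_le h0] at ht
  have := ht.2
  exact ne_of_gt (by linarith)

lemma regIncBeta_le_regIncBeta {a x y : ℝ} (b : ℝ) (ha : 0 < a) (h0 : 0 ≤ x) (hxy : x ≤ y)
    (h1 : y < 1) : regIncBeta x a b ≤ regIncBeta y a b := by
  unfold regIncBeta
  refine div_le_div_of_nonneg_right ?_ (intervalIntegral.integral_nonneg zero_le_one
    fun t ht => betaIntegrand_nonneg a b ht.1 ht.2)
  refine intervalIntegral.integral_mono_interval le_rfl h0 hxy ?_
    (intervalIntegrable_betaIntegrand b ha (h0.trans hxy) h1)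
  refine MeasureTheory.ae_restrict_of_forall_mem measurableSet_Ioc fun t ht => ?_
  exact betaIntegrand_nonneg a b ht.1.le (ht.2.trans h1.le)

theorem stmt_14 (d : ℕ) (hd : 2 ≤ d) (τ : ℝ) (hτ : τ ∈ Set.Ioo (0:ℝ) 1)
    (H U : ℝ → ℝ)
    (hH : ∀ R, H R = R * (1 - τ) - (1 - τ ^ 2) / 2)
    (hU : ∀ R, U R =
      (1 / 2) * regIncBeta ((2 * R * H R - (H R) ^ 2) / R ^ 2) (((d : ℝ) - 1) / 2) (1 / 2)) :
    MonotoneOn U (Set.Ici ((1 + τ) / 2)) := by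
  obtain ⟨hτ0, hτ1⟩ := hτ
  have hd' : (2 : ℝ) ≤ d := by exact_mod_cast hd
  have hsq : 0 < 1 - τ ^ 2 := by nlinarith
  have key : ∀ R : ℝ, 0 < R →
      (2 * R * H R - (H R) ^ 2) / R ^ 2 = 1 - (τ + (1 - τ ^ 2) / (2 * R)) ^ 2 := by
    intro R hR
    rw [hH]
    field_simp
    ring
  intro R hR S hS hRS
  simp only [Set.mem_Ici] at hR hS
  have hR0 : 0 < R := by linarith
  have hS0 : 0 < S := by linarith
  have hle : (1 - τ ^ 2) / (2 * S) ≤ (1 - τ ^ 2) / (2 * R) := by gcongr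
  have hpos : 0 < (1 - τ ^ 2) / (2 * S) := by positivity
  have hone : (1 - τ ^ 2) / (2 * R) ≤ 1 - τ := by
    rw [div_le_iff₀ (by linarith)]
    nlinarith
  rw [hU, hU, key R hR0, key S hS0]
  refine mul_le_mul_of_nonneg_left ?_ (by norm_num)
  refine regIncBeta_le_regIncBeta _ (by linarith) ?_ ?_ ?_ <;> nlinarith
end

section
/- Let d ≥ 1 be an integer, let p ≥ 1 and σ > 0 be real numbers, and let ‖y‖_p = (Σ_{i=1}^d |y_i|^p)^{1/p} denote the ℓ_p norm on ℝ^d. Then (∫_{ℝ^d} ‖y‖₂² · exp(−‖y‖_p/σ) dy) / (∫_{ℝ^d} exp(−‖y‖_p/σ) dy) = (dσ)² (d+1) · (Γ(d/p) Γ(3/p)) / (Γ(1/p) Γ((d+2)/p)), where Γ is the Gamma function. -/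
open MeasureTheory

theorem lintegral_comp_smul_of_pos {E : Type*} [NormedAddCommGroup E] [NormedSpace ℝ E]
    [FiniteDimensional ℝ E] [MeasurableSpace E] [BorelSpace E] (μ : Measure E)
    [μ.IsAddHaarMeasure] {f : E → ENNReal} (hf : Measurable f) {t : ℝ} (ht : 0 < t) :
    ∫⁻ x, f x ∂μ = ENNReal.ofReal (t ^ Module.finrank ℝ E) * ∫⁻ x, f (t • x) ∂μ := by
  have h := lintegral_map (μ := μ) hf (measurable_const_smul t)
  rw [Measure.map_addHaar_smul μ ht.ne', lintegral_smul_measure] at h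
  rw [← h, smul_eq_mul, ← mul_assoc, ← ENNReal.ofReal_mul (by positivity),
    abs_of_pos (by positivity), mul_inv_cancel₀ (by positivity), ENNReal.ofReal_one, one_mul]

theorem ofReal_exp_neg_eq_lintegral {a : ℝ} (ha : 0 ≤ a) :
    ENNReal.ofReal (Real.exp (-a)) =
      ∫⁻ s in Set.Ioi (0 : ℝ), if a < s then ENNReal.ofReal (Real.exp (-s)) else 0 := by
  have h : (fun s : ℝ => if a < s then ENNReal.ofReal (Real.exp (-s)) else 0) =
      (Set.Ioi a).indicator fun s => ENNReal.ofReal (Real.exp (-s)) := by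
    ext s
    simp [Set.indicator_apply]
  rw [h, setLIntegral_indicator measurableSet_Ioi,
    Set.inter_eq_left.2 (Set.Ioi_subset_Ioi ha), ← integral_exp_neg_Ioi a,
    ofReal_integral_eq_lintegral_ofReal (integrableOn_exp_neg_Ioi a)
      (Filter.Eventually.of_forall fun s => (Real.exp_pos _).le)]

section Homogeneous

variable {E : Type*} [NormedAddCommGroup E] [NormedSpace ℝ E] [FiniteDimensional ℝ E]
  [MeasurableSpace E] [BorelSpace E] (μ : Measure E) [μ.IsAddHaarMeasure] {F G : E → ℝ} {k q : ℝ}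

/-- Integrating a homogeneous function over the sublevel sets of another one. -/
theorem lintegral_sublevel_of_homogeneous (hF : Measurable F) (hG : Measurable G)
    (hFk : ∀ t > 0, ∀ y, F (t • y) = t ^ k * F y) (hGq : ∀ t > 0, ∀ y, G (t • y) = t ^ q * G y)
    (hq : 0 < q) {s : ℝ} (hs : 0 < s) :
    ∫⁻ y, (if G y < s then ENNReal.ofReal (F y) else 0) ∂μ =
      ENNReal.ofReal (s ^ ((Module.finrank ℝ E + k) / q)) *
        ∫⁻ y, (if G y < 1 then ENNReal.ofReal (F y) else 0) ∂μ := by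
  have ht : 0 < s ^ (1 / q) := by positivity
  have hsq : (s ^ (1 / q)) ^ q = s := by
    rw [← Real.rpow_mul hs.le, one_div_mul_cancel hq.ne', Real.rpow_one]
  have hpt (y : E) : (if G (s ^ (1 / q) • y) < s then ENNReal.ofReal (F (s ^ (1 / q) • y)) else 0) =
      ENNReal.ofReal ((s ^ (1 / q)) ^ k) * if G y < 1 then ENNReal.ofReal (F y) else 0 := by
    rw [hFk _ ht, hGq _ ht, hsq, mul_ite, mul_zero, ENNReal.ofReal_mul (by positivity)]
    simp only [mul_lt_iff_lt_one_right hs]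
  rw [lintegral_comp_smul_of_pos μ (Measurable.ite (measurableSet_lt hG measurable_const)
      hF.ennreal_ofReal measurable_const) ht]
  simp_rw [hpt]
  rw [lintegral_const_mul _ (Measurable.ite (measurableSet_lt hG measurable_const)
      hF.ennreal_ofReal measurable_const), ← mul_assoc, ← ENNReal.ofReal_mul (by positivity),
    ← Real.rpow_natCast, ← Real.rpow_add ht, ← Real.rpow_mul hs.le, one_div_mul_eq_div]

theorem lintegral_mul_exp_neg_of_homogeneous (hF : Measurable F) (hG : Measurable G)
    (hF0 : ∀ y, 0 ≤ F y) (hG0 : ∀ y, 0 ≤ G y)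
    (hFk : ∀ t > 0, ∀ y, F (t • y) = t ^ k * F y) (hGq : ∀ t > 0, ∀ y, G (t • y) = t ^ q * G y)
    (hk : 0 ≤ k) (hq : 0 < q) :
    ∫⁻ y, ENNReal.ofReal (F y * Real.exp (-G y)) ∂μ =
      ENNReal.ofReal (Real.Gamma ((Module.finrank ℝ E + k) / q + 1)) *
        ∫⁻ y, (if G y < 1 then ENNReal.ofReal (F y) else 0) ∂μ := by
  have hm : 0 < (Module.finrank ℝ E + k) / q + 1 := by positivity
  have hpt (y : E) : ENNReal.ofReal (F y * Real.exp (-G y)) = ∫⁻ s in Set.Ioi (0 : ℝ),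
      ENNReal.ofReal (Real.exp (-s)) * if G y < s then ENNReal.ofReal (F y) else 0 := by
    rw [ENNReal.ofReal_mul (hF0 y), ofReal_exp_neg_eq_lintegral (hG0 y),
      ← lintegral_const_mul' _ _ ENNReal.ofReal_ne_top]
    refine lintegral_congr fun s => ?_
    split_ifs <;> simp [mul_comm]
  simp_rw [hpt]
  rw [lintegral_lintegral_swap, Real.Gamma_eq_integral hm, ofReal_integral_eq_lintegral_ofReal
    (Real.GammaIntegral_convergent hm), ← lintegral_mul_const]
  · refine setLIntegral_congr_fun measurableSet_Ioi fun s hs => ?_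
    rw [lintegral_const_mul' _ _ ENNReal.ofReal_ne_top,
      lintegral_sublevel_of_homogeneous μ hF hG hFk hGq hq hs, add_sub_cancel_right,
      ENNReal.ofReal_mul (Real.exp_pos _).le, mul_assoc]
  · fun_prop
  · filter_upwards [ae_restrict_mem measurableSet_Ioi] with s hs
    have : 0 < s := hs
    simp only [Pi.zero_apply]
    positivity
  · refine Measurable.aemeasurable (Measurable.mul (by fun_prop) ?_)
    exact Measurable.ite (measurableSet_lt (hG.comp measurable_fst) measurable_snd)
      (hF.comp measurable_fst).ennreal_ofReal measurable_const

theorem integral_mul_exp_neg_of_homogeneous (hF : Measurable F) (hG : Measurable G)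
    (hF0 : ∀ y, 0 ≤ F y) (hG0 : ∀ y, 0 ≤ G y)
    (hFk : ∀ t > 0, ∀ y, F (t • y) = t ^ k * F y) (hGq : ∀ t > 0, ∀ y, G (t • y) = t ^ q * G y)
    (hk : 0 ≤ k) (hq : 0 < q) :
    ∫ y, F y * Real.exp (-G y) ∂μ = Real.Gamma ((Module.finrank ℝ E + k) / q + 1) *
        (∫⁻ y, (if G y < 1 then ENNReal.ofReal (F y) else 0) ∂μ).toReal := by
  have hm : 0 < (Module.finrank ℝ E + k) / q + 1 := by positivity
  rw [integral_eq_lintegral_of_nonneg_ae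
      (Filter.Eventually.of_forall fun y => mul_nonneg (hF0 y) (Real.exp_pos _).le)
      (by fun_prop), lintegral_mul_exp_neg_of_homogeneous μ hF hG hF0 hG0 hFk hGq hk hq,
    ENNReal.toReal_mul, ENNReal.toReal_ofReal (Real.Gamma_pos_of_pos hm).le]

/-- Comparison of the radial profiles `exp (-N / σ)` and `exp (-N ^ p)`, where `G = N ^ p` is
homogeneous of degree `p`. -/
theorem integral_mul_exp_neg_rpow_div_of_homogeneous {p σ : ℝ}
    (hF : Measurable F) (hG : Measurable G)
    (hF0 : ∀ y, 0 ≤ F y) (hG0 : ∀ y, 0 ≤ G y)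
    (hFk : ∀ t > 0, ∀ y, F (t • y) = t ^ k * F y) (hGp : ∀ t > 0, ∀ y, G (t • y) = t ^ p * G y)
    (hk : 0 ≤ k) (hp : 0 < p) (hσ : 0 < σ) :
    ∫ y, F y * Real.exp (-(G y ^ (1 / p)) / σ) ∂μ =
      Real.Gamma (Module.finrank ℝ E + k + 1) * σ ^ (Module.finrank ℝ E + k) /
        Real.Gamma ((Module.finrank ℝ E + k) / p + 1) * ∫ y, F y * Real.exp (-G y) ∂μ := by
  have hm : 0 < (Module.finrank ℝ E + k) / p + 1 := by positivity
  have hN : ∀ t > 0, ∀ y, G (t • y) ^ (1 / p) / σ = t ^ (1 : ℝ) * (G y ^ (1 / p) / σ) := by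
    intro t ht y
    rw [hGp t ht, Real.mul_rpow (by positivity) (hG0 y), ← Real.rpow_mul ht.le,
      mul_one_div_cancel hp.ne', mul_div_assoc]
  have hlt (y : E) : G y ^ (1 / p) / σ < 1 ↔ G y < σ ^ p := by
    rw [div_lt_one hσ, one_div, Real.rpow_inv_lt_iff_of_pos (hG0 y) hσ.le hp]
  simp_rw [neg_div]
  rw [integral_mul_exp_neg_of_homogeneous μ hF hG hF0 hG0 hFk hGp hk hp,
    integral_mul_exp_neg_of_homogeneous μ hF ((hG.pow_const _).div_const _) hF0
      (fun y => div_nonneg (Real.rpow_nonneg (hG0 y) _) hσ.le) hFk hN hk one_pos]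
  simp_rw [hlt]
  rw [lintegral_sublevel_of_homogeneous μ hF hG hFk hGp hp (by positivity), ENNReal.toReal_mul,
    ENNReal.toReal_ofReal (by positivity), ← Real.rpow_mul hσ.le, mul_div_cancel₀ _ hp.ne', div_one]
  field_simp [(Real.Gamma_pos_of_pos hm).ne']

end Homogeneous

theorem integral_abs_rpow_mul_exp_neg_abs_rpow {p q : ℝ} (hp : 0 < p) (hq : -1 < q) :
    ∫ x : ℝ, |x| ^ q * Real.exp (-|x| ^ p) = 2 / p * Real.Gamma ((q + 1) / p) := by
  rw [integral_comp_abs (f := fun x => x ^ q * Real.exp (-x ^ p)),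
    integral_rpow_mul_exp_neg_rpow hp hq]
  ring

theorem integral_exp_neg_sum_abs_rpow {ι : Type*} [Fintype ι] {p : ℝ} (hp : 0 < p) :
    ∫ y : ι → ℝ, Real.exp (-∑ i, |y i| ^ p) =
      (2 / p * Real.Gamma (1 / p)) ^ Fintype.card ι := by
  simp_rw [← Finset.sum_neg_distrib, Real.exp_sum]
  rw [integral_fintype_prod_volume_eq_pow fun x : ℝ => Real.exp (-|x| ^ p)]
  congr 1
  simpa using integral_abs_rpow_mul_exp_neg_abs_rpow hp (q := 0) (by norm_num)

theorem integral_sq_mul_exp_neg_sum_abs_rpow {ι : Type*} [Fintype ι] [DecidableEq ι] {p : ℝ}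
    (hp : 0 < p) (j : ι) :
    ∫ y : ι → ℝ, y j ^ 2 * Real.exp (-∑ i, |y i| ^ p) =
      2 / p * Real.Gamma (3 / p) * (2 / p * Real.Gamma (1 / p)) ^ (Fintype.card ι - 1) := by
  have hpt (y : ι → ℝ) : y j ^ 2 * Real.exp (-∑ i, |y i| ^ p) =
      ∏ i, |y i| ^ (if i = j then (2 : ℝ) else 0) * Real.exp (-|y i| ^ p) := by
    rw [Finset.prod_mul_distrib, ← Finset.sum_neg_distrib, Real.exp_sum]
    congr 1
    rw [Finset.prod_eq_single j (fun i _ hi => by simp [hi]) (by simp)]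
    simp
  simp_rw [hpt]
  rw [integral_fintype_prod_volume_eq_prod
    (fun i (x : ℝ) => |x| ^ (if i = j then (2 : ℝ) else 0) * Real.exp (-|x| ^ p)),
    ← Finset.mul_prod_erase _ _ (Finset.mem_univ j),
    Finset.prod_congr rfl (g := fun _ => 2 / p * Real.Gamma (1 / p)),
    Finset.prod_const, Finset.card_erase_of_mem (Finset.mem_univ j), Finset.card_univ, if_pos rfl,
    integral_abs_rpow_mul_exp_neg_abs_rpow hp (by norm_num)]
  · norm_num
  · intro i hi
    rw [if_neg (Finset.ne_of_mem_erase hi),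
      integral_abs_rpow_mul_exp_neg_abs_rpow hp (by norm_num), zero_add]

theorem integral_sum_sq_mul_exp_neg_sum_abs_rpow {ι : Type*} [Fintype ι] {p : ℝ} (hp : 0 < p) :
    ∫ y : ι → ℝ, (∑ i, y i ^ 2) * Real.exp (-∑ i, |y i| ^ p) =
      Fintype.card ι * (2 / p * Real.Gamma (3 / p) *
        (2 / p * Real.Gamma (1 / p)) ^ (Fintype.card ι - 1)) := by
  classical
  have h1 : 0 < Real.Gamma (1 / p) := Real.Gamma_pos_of_pos (by positivity)
  have h3 : 0 < Real.Gamma (3 / p) := Real.Gamma_pos_of_pos (by positivity)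
  simp_rw [Finset.sum_mul]
  rw [integral_finsetSum]
  · simp [integral_sq_mul_exp_neg_sum_abs_rpow hp]
  · intro j _
    refine Integrable.of_integral_ne_zero ?_
    rw [integral_sq_mul_exp_neg_sum_abs_rpow hp]
    positivity

theorem stmt_18 (d : ℕ) (hd : 1 ≤ d) (p σ : ℝ) (hp : 1 ≤ p) (hσ : 0 < σ) :
    (∫ y : Fin d → ℝ, (∑ i, (y i) ^ 2) *
        Real.exp (-((∑ i, |y i| ^ p) ^ (1 / p)) / σ)) /
      (∫ y : Fin d → ℝ, Real.exp (-((∑ i, |y i| ^ p) ^ (1 / p)) / σ))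
      = ((d : ℝ) * σ) ^ 2 * ((d : ℝ) + 1) *
          (Real.Gamma ((d : ℝ) / p) * Real.Gamma (3 / p) /
            (Real.Gamma (1 / p) * Real.Gamma (((d : ℝ) + 2) / p))) := by
  have hp0 : 0 < p := by linarith
  have hd0 : (0 : ℝ) < d := by exact_mod_cast hd
  have hG : Measurable fun y : Fin d → ℝ => ∑ i, |y i| ^ p := by fun_prop
  have hG0 (y : Fin d → ℝ) : 0 ≤ ∑ i, |y i| ^ p := by positivity
  have hGp : ∀ t > 0, ∀ y : Fin d → ℝ, ∑ i, |(t • y) i| ^ p = t ^ p * ∑ i, |y i| ^ p := by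
    intro t ht y
    simp_rw [Pi.smul_apply, smul_eq_mul, abs_mul, abs_of_pos ht,
      Real.mul_rpow ht.le (abs_nonneg _), Finset.mul_sum]
  have hnum := integral_mul_exp_neg_rpow_div_of_homogeneous (volume : Measure (Fin d → ℝ))
    (F := fun y => ∑ i, y i ^ 2) (k := 2) (by fun_prop) hG (fun y => by positivity) hG0
    (fun t ht y => by simp [mul_pow, Finset.mul_sum]) hGp (by norm_num) hp0 hσ
  have hden := integral_mul_exp_neg_rpow_div_of_homogeneous (volume : Measure (Fin d → ℝ))
    (F := fun _ => 1) (k := 0) (by fun_prop) hG (fun y => by positivity) hG0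
    (fun t ht y => by simp) hGp le_rfl hp0 hσ
  simp only [one_mul, add_zero, Module.finrank_fin_fun] at hnum hden
  rw [integral_sum_sq_mul_exp_neg_sum_abs_rpow hp0] at hnum
  rw [integral_exp_neg_sum_abs_rpow hp0] at hden
  rw [hnum, hden, Fintype.card_fin, Real.Gamma_add_one (s := (d + 2) / p) (by positivity),
    Real.Gamma_add_one (s := d / p) (by positivity), Real.Gamma_add_one (s := d + 2) (by positivity),
    show (d + 2 : ℝ) = d + 1 + 1 by ring, Real.Gamma_add_one (s := d + 1) (by positivity),
    show (d + 1 + 1 : ℝ) = d + 2 by ring, Real.rpow_add hσ, Real.rpow_two]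
  have h1 : 0 < Real.Gamma (1 / p) := Real.Gamma_pos_of_pos (by positivity)
  have h2 : 0 < Real.Gamma ((d + 2) / p) := Real.Gamma_pos_of_pos (by positivity)
  have h3 : 0 < Real.Gamma (d / p) := Real.Gamma_pos_of_pos (by positivity)
  have h4 : 0 < Real.Gamma (d + 1) := Real.Gamma_pos_of_pos (by positivity)
  obtain ⟨n, rfl⟩ := Nat.exists_eq_add_of_le' hd
  rw [Nat.add_sub_cancel, pow_succ (2 / p * Real.Gamma (1 / p)) n]
  field_simp
end

section
/- Let σ > 0 and ε > 0 be real numbers with σε ≤ 1. Then (∫_{−∞}^{(1−σε)/2} (1/(2σ)) · exp(−|y|/σ) dy) − e^ε · (∫_{−∞}^{(1−σε)/2} (1/(2σ)) · exp(−|y − 1|/σ) dy) = 1 − exp((ε − 1/σ)/2). -/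
open MeasureTheory Real

theorem integrableOn_exp_neg_abs_div_Iic_zero {σ : ℝ} (hσ : 0 < σ) :
    IntegrableOn (fun y : ℝ => (1 / (2 * σ)) * Real.exp (-|y| / σ)) (Set.Iic 0) := by
  refine IntegrableOn.congr_fun
    ((integrableOn_exp_mul_Iic (inv_pos.2 hσ) 0).const_mul (1 / (2 * σ))) (fun y hy => ?_) measurableSet_Iic
  have hy' : y ≤ 0 := hy
  simp only [abs_of_nonpos hy', neg_neg, div_eq_inv_mul]

theorem integral_laplace_Iic_of_le {σ a m : ℝ} (hσ : 0 < σ) (ham : a ≤ m) :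
    ∫ y in Set.Iic a, (1 / (2 * σ)) * Real.exp (-|y - m| / σ) = Real.exp ((a - m) / σ) / 2 := by
  have hcongr : ∀ y ∈ Set.Iic a, (1 / (2 * σ)) * Real.exp (-|y - m| / σ)
      = (1 / (2 * σ) * Real.exp (-m / σ)) * Real.exp (σ⁻¹ * y) := fun y hy => by
    have hy' : y ≤ a := hy
    rw [abs_of_nonpos (by linarith), mul_assoc, ← Real.exp_add]
    ring_nf
  rw [setIntegral_congr_fun measurableSet_Iic hcongr, integral_const_mul,
    integral_exp_mul_Iic (inv_pos.2 hσ), sub_div, sub_eq_add_neg, Real.exp_add,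
    ← neg_div, div_eq_inv_mul a σ]
  field_simp

theorem integral_laplace_zero_Iic_of_nonneg {σ a : ℝ} (hσ : 0 < σ) (ha : 0 ≤ a) :
    ∫ y in Set.Iic a, (1 / (2 * σ)) * Real.exp (-|y| / σ) = 1 - Real.exp (-a / σ) / 2 := by
  have hcont : Continuous fun y : ℝ => (1 / (2 * σ)) * Real.exp (-|y| / σ) := by fun_prop
  have hright : ∫ y in (0 : ℝ)..a, (1 / (2 * σ)) * Real.exp (-|y| / σ)
      = 1 / 2 - Real.exp (-a / σ) / 2 := by
    rw [intervalIntegral.integral_eq_sub_of_hasDerivAt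
      (f := fun y => -(Real.exp (-y / σ) / 2)) (fun y hy => ?_) (hcont.intervalIntegrable _ _)]
    · simp only [neg_zero, zero_div, Real.exp_zero]
      ring
    · rw [Set.uIcc_of_le ha] at hy
      rw [abs_of_nonneg hy.1]
      refine ((((hasDerivAt_neg y).div_const σ).exp).div_const 2).neg.congr_deriv ?_
      field_simp
  have hleft : ∫ y in Set.Iic (0 : ℝ), (1 / (2 * σ)) * Real.exp (-|y| / σ) = 1 / 2 := by
    simpa using integral_laplace_Iic_of_le hσ (le_refl (0 : ℝ))
  have hint := integrableOn_exp_neg_abs_div_Iic_zero hσ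
  have hinta : IntegrableOn (fun y : ℝ => (1 / (2 * σ)) * Real.exp (-|y| / σ)) (Set.Iic a) := by
    rw [← Set.Iic_union_Ioc_eq_Iic ha]
    exact hint.union (hcont.integrableOn_Ioc)
  have hsub := intervalIntegral.integral_Iic_sub_Iic hint hinta
  linarith

theorem stmt_19 (σ ε : ℝ) (hσ : 0 < σ) (hε : 0 < ε) (h : σ * ε ≤ 1) :
    (∫ y in Set.Iic ((1 - σ * ε) / 2), (1 / (2 * σ)) * Real.exp (-|y| / σ))
      - Real.exp ε * ∫ y in Set.Iic ((1 - σ * ε) / 2), (1 / (2 * σ)) * Real.exp (-|y - 1| / σ)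
      = 1 - Real.exp ((ε - 1 / σ) / 2) := by
  have hpos : 0 < σ * ε := mul_pos hσ hε
  rw [integral_laplace_zero_Iic_of_nonneg hσ (by linarith),
    integral_laplace_Iic_of_le hσ (by linarith), ← mul_div_assoc, ← Real.exp_add,
    show -((1 - σ * ε) / 2) / σ = (ε - 1 / σ) / 2 by field_simp; ring,
    show ε + ((1 - σ * ε) / 2 - 1) / σ = (ε - 1 / σ) / 2 by field_simp; ring]
  ring
end
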